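/- Let X be a topological space, let X₀ ⊆ X be a closed subset that is locally connected in its subspace topology, and let K ⊆ X₀ be a closed subset of X. Let W be a connected component of X₀ ∖ K (with respect to the subspace topology on X₀ ∖ K). Let M be a topological space and H : M → X a continuous map whose range is disjoint from K. Then H⁻¹(W) and H⁻¹(X₀ ∖ W) are disjoint closed subsets of M whose union is H⁻¹(X₀). -/

import Mathlib

universe u v

/-- If `K ⊆ X` is closed, the difference `S \ K` is open in `S`, hence inherits local
connectedness from `S`. -/
theorem locallyConnectedSpace_diff {X : Type*} [TopologicalSpace X] {S K : Set X}
    [LocallyConnectedSpace ↥S] (hK : IsClosed K) : LocallyConnectedSpace ↥(S \ K) := by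
  refine (Topology.IsOpenEmbedding.inclusion (Set.sdiff_subset : S \ K ⊆ S)
    ?_).locallyConnectedSpace
  convert hK.isOpen_compl.preimage (continuous_subtype_val : Continuous ((↑) : S → X)) using 1
  ext y
  simp

/-- A relatively closed subset of `S \ K`, with `S` closed, has closed preimage under any
continuous map whose range misses `K`. -/
theorem isClosed_preimage_image_val_diff {X M : Type*} [TopologicalSpace X]
    [TopologicalSpace M] {S K : Set X} (hS : IsClosed S) {C : Set ↥(S \ K)}
    (hC : IsClosed C) {f : M → X} (hf : Continuous f) (hfK : ∀ m, f m ∉ K) :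
    IsClosed (f ⁻¹' (Subtype.val '' C)) := by
  obtain ⟨Z, hZ, rfl⟩ := isClosed_induced_iff.mp hC
  convert (hZ.inter hS).preimage hf using 1
  ext m
  simp [hfK m, and_comm]

/-- Lemma 6.2 of the paper: if `X₀ ⊆ X` is closed and locally
connected, `K ⊆ X₀` is closed, `W` is a connected component of `X₀ ∖ K`, and
`H : M → X` is a continuous map whose range misses `K`, then `H⁻¹(W)` and
`H⁻¹(X₀ ∖ W)` are disjoint closed subsets of `M` whose union is `H⁻¹(X₀)`. -/
theorem preimages_of_component_closed {X : Type u} [TopologicalSpace X]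
    (X₀ : Set X) (hX₀closed : IsClosed X₀)
    (hlc : LocallyConnectedSpace ↥X₀)
    (K : Set X) (hKX₀ : K ⊆ X₀) (hKclosed : IsClosed K)
    (W : Set X) (x : ↥(X₀ \ K)) (hW : W = Subtype.val '' connectedComponent x)
    {M : Type v} [TopologicalSpace M] (H : M → X) (hHcont : Continuous H)
    (hrange : ∀ m : M, H m ∉ K) :
    IsClosed (H ⁻¹' W) ∧ IsClosed (H ⁻¹' (X₀ \ W)) ∧
      Disjoint (H ⁻¹' W) (H ⁻¹' (X₀ \ W)) ∧
      H ⁻¹' W ∪ H ⁻¹' (X₀ \ W) = H ⁻¹' X₀ := by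
  subst hW
  have : LocallyConnectedSpace ↥(X₀ \ K) := locallyConnectedSpace_diff hKclosed
  have hsub : Subtype.val '' connectedComponent x ⊆ X₀ := by
    rintro _ ⟨y, -, rfl⟩
    exact y.2.1
  refine ⟨isClosed_preimage_image_val_diff hX₀closed isClosed_connectedComponent hHcont hrange,
    ?_, Set.disjoint_sdiff_right.preimage H, ?_⟩
  · convert isClosed_preimage_image_val_diff hX₀closed
      (isOpen_connectedComponent (x := x)).isClosed_compl hHcont hrange using 1
    ext m
    simp [hrange m]
  · rw [← Set.preimage_union, Set.union_sdiff_cancel hsub]
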